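/- Let d ∈ ℕ and let V : ℝ^d → ℝ be Borel measurable. Define f(t) = sup_{x,y∈ℝ^d} S(V,t,x,y) ∈ [0,∞] and F(h) = sup_{0<s≤h} f(s) for t, h > 0. Then for all t, h > 0, f(t) ≤ F(h) + t·f(h)/h (an inequality in [0,∞]). -/

import Mathlib

open MeasureTheory Real
open scoped ENNReal

/-- The Gauss–Weierstrass kernel on `ℝ^d`. -/
noncomputable def gk (d : ℕ) (t : ℝ) (x y : EuclideanSpace ℝ (Fin d)) : ℝ :=
  (4 * Real.pi * t) ^ (-(d : ℝ) / 2) * Real.exp (-‖y - x‖ ^ 2 / (4 * t))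

/-- `S(V,t,x,y)`, the potential of `|V|` for the Gaussian bridges. -/
noncomputable def Sv (d : ℕ) (V : EuclideanSpace ℝ (Fin d) → ℝ) (t : ℝ)
    (x y : EuclideanSpace ℝ (Fin d)) : ℝ≥0∞ :=
  ∫⁻ s in Set.Ioo 0 t, ∫⁻ z,
    ENNReal.ofReal (gk d s x z * gk d (t - s) z y / gk d t x y * |V z|)

/-- `f(t) = sup_{x,y} S(V,t,x,y)`. -/
noncomputable def fS (d : ℕ) (V : EuclideanSpace ℝ (Fin d) → ℝ) (t : ℝ) : ℝ≥0∞ :=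
  ⨆ (x : EuclideanSpace ℝ (Fin d)) (y : EuclideanSpace ℝ (Fin d)), Sv d V t x y

/-- `F(h) = sup_{0 < s ≤ h} f(s)`. -/
noncomputable def FS (d : ℕ) (V : EuclideanSpace ℝ (Fin d) → ℝ) (h : ℝ) : ℝ≥0∞ :=
  ⨆ (s : ℝ) (_ : s ∈ Set.Ioc (0 : ℝ) h), fS d V s

section GaussKernel

variable {d : ℕ}

@[fun_prop]
lemma Measurable.gk {α : Type*} [MeasurableSpace α] {t : α → ℝ}
    {x y : α → EuclideanSpace ℝ (Fin d)} (ht : Measurable t) (hx : Measurable x)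
    (hy : Measurable y) : Measurable fun a => gk d (t a) (x a) (y a) := by
  unfold _root_.gk
  fun_prop

lemma gk_pos {t : ℝ} (ht : 0 < t) (x y : EuclideanSpace ℝ (Fin d)) : 0 < gk d t x y := by
  unfold gk
  positivity

/-- Completing the square in the exponent of a product of two Gaussian kernels. -/
lemma norm_sq_div_add_norm_sq_div {s t : ℝ} (hs : 0 < s) (ht : 0 < t)
    (x y z : EuclideanSpace ℝ (Fin d)) :
    -‖z - x‖ ^ 2 / (4 * s) + -‖y - z‖ ^ 2 / (4 * t) =
      -‖y - x‖ ^ 2 / (4 * (s + t)) +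
        -((s + t) / (4 * s * t)) * ‖z - (x + (s / (s + t)) • (y - x))‖ ^ 2 := by
  have h1 : y - z = (y - x) - (z - x) := by abel
  have h2 : z - (x + (s / (s + t)) • (y - x)) = (z - x) - (s / (s + t)) • (y - x) := by abel
  rw [h1, h2]
  generalize z - x = u
  generalize y - x = v
  rw [norm_sub_sq_real, norm_sub_sq_real, norm_smul, real_inner_smul_right, mul_pow,
    real_inner_comm u v, norm_eq_abs, sq_abs]
  field_simp
  ring

lemma gk_mul_gk {s t : ℝ} (hs : 0 < s) (ht : 0 < t) (x y z : EuclideanSpace ℝ (Fin d)) :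
    gk d s x z * gk d t z y = gk d (s + t) x y *
      ((π / ((s + t) / (4 * s * t))) ^ (-(d : ℝ) / 2) *
        rexp (-((s + t) / (4 * s * t)) * ‖z - (x + (s / (s + t)) • (y - x))‖ ^ 2)) := by
  unfold gk
  have hc : (4 * π * s) ^ (-(d : ℝ) / 2) * (4 * π * t) ^ (-(d : ℝ) / 2) =
      (4 * π * (s + t)) ^ (-(d : ℝ) / 2) * (π / ((s + t) / (4 * s * t))) ^ (-(d : ℝ) / 2) := by
    rw [← mul_rpow (by positivity) (by positivity), ← mul_rpow (by positivity) (by positivity)]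
    congr 1
    field_simp
  rw [mul_mul_mul_comm, ← exp_add, norm_sq_div_add_norm_sq_div hs ht, exp_add, hc]
  ring

lemma integrable_rexp_neg_mul_norm_sq {b : ℝ} (hb : 0 < b) :
    Integrable fun z : EuclideanSpace ℝ (Fin d) => rexp (-b * ‖z‖ ^ 2) := by
  have h := (GaussianFourier.integrable_cexp_neg_mul_sq_norm_add (b := (b : ℂ))
    (by simpa using hb) 0 (0 : EuclideanSpace ℝ (Fin d))).norm
  refine h.congr (ae_of_all _ fun z => ?_)
  simp [Complex.norm_exp, ← Complex.ofReal_pow, ← Complex.ofReal_mul, ← Complex.ofReal_neg]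

/-- The Chapman–Kolmogorov equation for the Gauss–Weierstrass kernel. -/
lemma lintegral_gk_mul_gk {s t : ℝ} (hs : 0 < s) (ht : 0 < t)
    (x y : EuclideanSpace ℝ (Fin d)) :
    ∫⁻ z, ENNReal.ofReal (gk d s x z) * ENNReal.ofReal (gk d t z y) =
      ENNReal.ofReal (gk d (s + t) x y) := by
  have hb : 0 < (s + t) / (4 * s * t) := by positivity
  simp_rw [← ENNReal.ofReal_mul (gk_pos hs _ _).le, gk_mul_gk hs ht]
  rw [← ofReal_integral_eq_lintegral_ofReal]
  · rw [integral_const_mul, integral_const_mul,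
      integral_sub_right_eq_self
        (fun z : EuclideanSpace ℝ (Fin d) => rexp (-((s + t) / (4 * s * t)) * ‖z‖ ^ 2)),
      GaussianFourier.integral_rexp_neg_mul_sq_norm hb, finrank_euclideanSpace_fin,
      ← rpow_add (by positivity), neg_div, neg_add_cancel, rpow_zero, mul_one]
  · exact (((integrable_rexp_neg_mul_norm_sq hb).comp_sub_right _).const_mul _).const_mul _
  · have := gk_pos (add_pos hs ht) x y
    exact ae_of_all _ fun z => by positivity

end GaussKernel

section BridgePotential

variable {d : ℕ} {V : EuclideanSpace ℝ (Fin d) → ℝ}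

lemma Sv_mul_gk {t : ℝ} (ht : 0 < t) (x y : EuclideanSpace ℝ (Fin d)) :
    Sv d V t x y * ENNReal.ofReal (gk d t x y) =
      ∫⁻ s in Set.Ioo 0 t, ∫⁻ z, ENNReal.ofReal (gk d s x z) *
        ENNReal.ofReal (gk d (t - s) z y) * ENNReal.ofReal |V z| := by
  have hg := gk_pos ht x y
  unfold Sv
  rw [← lintegral_mul_const' _ _ ENNReal.ofReal_ne_top]
  refine setLIntegral_congr_fun measurableSet_Ioo fun s hs => ?_
  rw [← lintegral_mul_const' _ _ ENNReal.ofReal_ne_top]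
  refine lintegral_congr fun z => ?_
  have h1 := gk_pos hs.1 x z
  have h2 := gk_pos (sub_pos.2 hs.2) z y
  rw [← ENNReal.ofReal_mul (by positivity), ← ENNReal.ofReal_mul (by positivity),
    ← ENNReal.ofReal_mul (by positivity)]
  congr 1
  field_simp

lemma Sv_mul_gk_le {t : ℝ} (x y : EuclideanSpace ℝ (Fin d)) :
    Sv d V t x y * ENNReal.ofReal (gk d t x y) ≤ fS d V t * ENNReal.ofReal (gk d t x y) := by
  gcongr
  exact le_iSup₂ (f := fun x y => Sv d V t x y) x y

lemma lintegral_Ioo_add_left (hV : Measurable V) {a b : ℝ} (ha : 0 < a) (hb : 0 < b)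
    (x y : EuclideanSpace ℝ (Fin d)) :
    ∫⁻ s in Set.Ioo 0 a, ∫⁻ z, ENNReal.ofReal (gk d s x z) *
        ENNReal.ofReal (gk d (a + b - s) z y) * ENNReal.ofReal |V z| ≤
      fS d V a * ENNReal.ofReal (gk d (a + b) x y) := by
  calc
    _ = ∫⁻ s in Set.Ioo 0 a, ∫⁻ z, ∫⁻ w, ENNReal.ofReal (gk d s x z) *
          ENNReal.ofReal (gk d (a - s) z w) * ENNReal.ofReal |V z| *
          ENNReal.ofReal (gk d b w y) := by
      refine setLIntegral_congr_fun measurableSet_Ioo fun s hs => lintegral_congr fun z => ?_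
      rw [add_sub_right_comm, ← lintegral_gk_mul_gk (sub_pos.2 hs.2) hb,
        ← lintegral_const_mul _ (by fun_prop), ← lintegral_mul_const _ (by fun_prop)]
      exact lintegral_congr fun w => by ring
    _ = ∫⁻ s in Set.Ioo 0 a, ∫⁻ w, ∫⁻ z, ENNReal.ofReal (gk d s x z) *
          ENNReal.ofReal (gk d (a - s) z w) * ENNReal.ofReal |V z| *
          ENNReal.ofReal (gk d b w y) :=
      lintegral_congr fun s => lintegral_lintegral_swap (by fun_prop)
    _ = ∫⁻ w, ∫⁻ s in Set.Ioo 0 a, ∫⁻ z, ENNReal.ofReal (gk d s x z) *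
          ENNReal.ofReal (gk d (a - s) z w) * ENNReal.ofReal |V z| *
          ENNReal.ofReal (gk d b w y) :=
      lintegral_lintegral_swap (Measurable.lintegral_prod_right (by fun_prop)).aemeasurable
    _ = ∫⁻ w, Sv d V a x w * ENNReal.ofReal (gk d a x w) * ENNReal.ofReal (gk d b w y) := by
      simp_rw [Sv_mul_gk ha, lintegral_mul_const' _ _ ENNReal.ofReal_ne_top]
    _ ≤ ∫⁻ w, fS d V a * (ENNReal.ofReal (gk d a x w) * ENNReal.ofReal (gk d b w y)) := by
      refine lintegral_mono fun w => ?_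
      rw [← mul_assoc]
      gcongr ?_ * _
      exact Sv_mul_gk_le x w
    _ = _ := by rw [lintegral_const_mul _ (by fun_prop), lintegral_gk_mul_gk ha hb]

lemma gk_comm (t : ℝ) (x y : EuclideanSpace ℝ (Fin d)) : gk d t x y = gk d t y x := by
  unfold gk
  rw [norm_sub_rev]

/-- The mirror image of `lintegral_Ioo_add_left` under time reversal. -/
lemma lintegral_Ioo_add_right (hV : Measurable V) {a b : ℝ} (ha : 0 < a) (hb : 0 < b)
    (x y : EuclideanSpace ℝ (Fin d)) :
    ∫⁻ s in Set.Ioo a (a + b), ∫⁻ z, ENNReal.ofReal (gk d s x z) *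
        ENNReal.ofReal (gk d (a + b - s) z y) * ENNReal.ofReal |V z| ≤
      fS d V b * ENNReal.ofReal (gk d (a + b) x y) := by
  have h := lintegral_Ioo_add_left hV hb ha y x
  rw [gk_comm _ y x, add_comm b a] at h
  refine le_of_eq_of_le ?_ h
  have hp := (Measure.measurePreserving_sub_left (volume : Measure ℝ)
      (a + b)).setLIntegral_comp_preimage_emb
    (MeasurableEquiv.subLeft (a + b)).measurableEmbedding
    (fun s => ∫⁻ z, ENNReal.ofReal (gk d s y z) *
        ENNReal.ofReal (gk d (a + b - s) z x) * ENNReal.ofReal |V z|) (Set.Ioo 0 b)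
  rw [← hp, Set.preimage_const_sub_Ioo, add_sub_cancel_right, sub_zero]
  refine lintegral_congr fun s => lintegral_congr fun z => ?_
  rw [sub_sub_cancel, gk_comm _ y z, gk_comm _ z x]
  ring

lemma fS_add_le (hV : Measurable V) {a b : ℝ} (ha : 0 < a) (hb : 0 < b) :
    fS d V (a + b) ≤ fS d V a + fS d V b := by
  refine iSup₂_le fun x y => ?_
  have hg : ENNReal.ofReal (gk d (a + b) x y) ≠ 0 := by
    simpa using gk_pos (add_pos ha hb) x y
  rw [← ENNReal.mul_le_mul_iff_left hg ENNReal.ofReal_ne_top, Sv_mul_gk (add_pos ha hb),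
    add_mul, ← Set.Ioc_union_Ioo_eq_Ioo ha.le (lt_add_of_pos_right a hb)]
  refine (lintegral_union_le _ _ _).trans ?_
  rw [setLIntegral_congr Ioo_ae_eq_Ioc.symm]
  exact add_le_add (lintegral_Ioo_add_left hV ha hb x y) (lintegral_Ioo_add_right hV ha hb x y)

lemma fS_add_nat_mul_le (hV : Measurable V) {r h : ℝ} (hr : 0 < r) (hh : 0 < h) (n : ℕ) :
    fS d V (r + n * h) ≤ fS d V r + n * fS d V h := by
  induction n with
  | zero => simp
  | succ n ih =>
    have hrn : 0 < r + n * h := by positivity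
    calc
      fS d V (r + (n + 1 : ℕ) * h) = fS d V ((r + n * h) + h) := by push_cast; ring_nf
      _ ≤ fS d V (r + n * h) + fS d V h := fS_add_le hV hrn hh
      _ ≤ fS d V r + n * fS d V h + fS d V h := by gcongr
      _ = _ := by push_cast; ring

end BridgePotential

theorem fS_le_FS_add
    (d : ℕ) (V : EuclideanSpace ℝ (Fin d) → ℝ) (hV : Measurable V) :
    ∀ t h : ℝ, 0 < t → 0 < h →
      fS d V t ≤ FS d V h + ENNReal.ofReal (t / h) * fS d V h := by
  intro t h ht hh
  have hth : 0 < t / h := div_pos ht hh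
  obtain ⟨n, hn⟩ : ∃ n : ℕ, ⌈t / h⌉₊ = n + 1 :=
    Nat.exists_eq_succ_of_ne_zero (Nat.ceil_pos.2 hth).ne'
  have hlt : (n : ℝ) < t / h := Nat.lt_ceil.1 (by omega)
  have hle : t / h ≤ n + 1 := by
    have := Nat.le_ceil (t / h)
    rw [hn] at this
    exact_mod_cast this
  rw [lt_div_iff₀ hh] at hlt
  rw [div_le_iff₀ hh] at hle
  calc
    fS d V t = fS d V ((t - n * h) + n * h) := by rw [sub_add_cancel]
    _ ≤ fS d V (t - n * h) + n * fS d V h := fS_add_nat_mul_le hV (by linarith) hh n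
    _ ≤ FS d V h + ENNReal.ofReal (t / h) * fS d V h := by
      gcongr
      · exact le_iSup₂ (f := fun s (_ : s ∈ Set.Ioc (0 : ℝ) h) => fS d V s) (t - n * h)
          ⟨by linarith, by linarith⟩
      · rw [← ENNReal.ofReal_natCast]
        exact ENNReal.ofReal_le_ofReal ((le_div_iff₀ hh).2 hlt.le)
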